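/- arXiv:0711.4414 — 2 statements merged into one kernel-verified Lean document; each statement's English description precedes it below -/
import Mathlib

section
/- Let h ∈ ℂ^{1×M_t} be a nonzero row vector, let K ≥ 1, let G_k ∈ ℂ^{M_k×M_t} and Γ_k ≥ 0 for k = 1,…,K, and let P_t > 0. Consider maximizing log₂(1 + h S h^†) over all Hermitian positive semidefinite S ∈ ℂ^{M_t×M_t} with Tr(S) ≤ P_t and Tr(G_k S G_k^†) ≤ Γ_k for every k. Then there exists an optimal S of rank at most one; that is, there exists v ∈ ℂ^{M_t} with ‖v‖² ≤ P_t and ‖G_k v‖² ≤ Γ_k for every k such that log₂(1 + |h v|²) equals the supremum of the problem (beamforming is optimal for the MISO secondary channel even with multiple primary receivers). -/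
open Matrix
open scoped ComplexOrder

theorem Matrix.re_trace_mul_conjTranspose_self {m n : Type*} [Fintype m] [Fintype n]
    (C : Matrix m n ℂ) : (C * Cᴴ).trace.re = ∑ j, ∑ k, ‖C j k‖ ^ 2 := by
  simp [Matrix.trace, Matrix.mul_apply, Complex.mul_conj, Complex.normSq_eq_norm_sq,
    -Complex.mul_re, -Complex.ofReal_pow]

theorem Matrix.sum_norm_sq_mulVec_le {m n : Type*} [Fintype m] [Fintype n]
    (C : Matrix m n ℂ) (w : n → ℂ) :
    ∑ j, ‖(C *ᵥ w) j‖ ^ 2 ≤ (∑ j, ∑ k, ‖C j k‖ ^ 2) * ∑ k, ‖w k‖ ^ 2 := by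
  rw [Finset.sum_mul]
  refine Finset.sum_le_sum fun j _ => ?_
  refine le_trans ?_ (Finset.sum_mul_sq_le_sq_mul_sq Finset.univ (fun k => ‖C j k‖) fun k => ‖w k‖)
  gcongr
  simpa [Matrix.mulVec, dotProduct] using
    norm_sum_le Finset.univ (fun k => C j k * w k)

theorem Matrix.re_trace_mul_vecMulVec_star {m n : Type*} [Fintype m] [Fintype n]
    (A : Matrix m n ℂ) (v : n → ℂ) :
    (A * vecMulVec v (star v) * Aᴴ).trace.re = ∑ j, ‖(A *ᵥ v) j‖ ^ 2 := by
  rw [Matrix.mul_vecMulVec, Matrix.vecMulVec_mul, ← Matrix.star_mulVec]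
  simp [Matrix.trace, vecMulVec_apply, Complex.mul_conj, Complex.normSq_eq_norm_sq,
    -Complex.mul_re, -Complex.ofReal_pow]

open scoped MatrixOrder Matrix.Norms.L2Operator in
/-- For a positive semidefinite `S` and a row vector `h`, the vector `v = S hᴴ / √(h S hᴴ)`
satisfies `|h v|² = h S hᴴ` and `v vᴴ ≤ S`, the latter tested against traces. -/
theorem Matrix.PosSemidef.exists_rankOne_le {n : Type*} [Fintype n] [DecidableEq n]
    {S : Matrix n n ℂ} (hS : S.PosSemidef) (h : Matrix (Fin 1) n ℂ) :
    ∃ v : n → ℂ, ‖(h *ᵥ v) 0‖ ^ 2 = ((h * S * hᴴ) 0 0).re ∧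
      ∀ (m : ℕ) (A : Matrix (Fin m) n ℂ),
        ∑ j, ‖(A *ᵥ v) j‖ ^ 2 ≤ (A * S * Aᴴ).trace.re := by
  obtain ⟨B, rfl⟩ : ∃ B : Matrix n n ℂ, S = Bᴴ * B :=
    CStarAlgebra.nonneg_iff_eq_star_mul_self.mp hS.nonneg
  set w : n → ℂ := B *ᵥ (star (h 0)) with hw
  set a : ℝ := ∑ k, ‖w k‖ ^ 2 with ha
  have ha0 : 0 ≤ a := by positivity
  have hsq : ‖((√a)⁻¹ : ℂ)‖ ^ 2 = a⁻¹ := by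
    rw [norm_inv, Complex.norm_real, Real.norm_of_nonneg (Real.sqrt_nonneg a), inv_pow,
      Real.sq_sqrt ha0]
  have hhw : (h *ᵥ (Bᴴ *ᵥ w)) 0 = (a : ℂ) := by
    have : (h *ᵥ (Bᴴ *ᵥ w)) 0 = star w ⬝ᵥ w := by
      rw [hw, Matrix.star_mulVec, star_star, ← Matrix.dotProduct_mulVec]
      rfl
    rw [this, ha]
    simp [dotProduct, Complex.conj_mul']
  have hmat : (h * (Bᴴ * B) * hᴴ) 0 0 = (h *ᵥ (Bᴴ *ᵥ w)) 0 := by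
    rw [hw, Matrix.mulVec_mulVec, Matrix.mulVec_mulVec, Matrix.mul_assoc, Matrix.mul_assoc,
      ← Matrix.mul_assoc, ← Matrix.mul_assoc]
    rfl
  refine ⟨((√a)⁻¹ : ℂ) • (Bᴴ *ᵥ w), ?_, fun m A => ?_⟩
  · rw [Matrix.mulVec_smul, Pi.smul_apply, norm_smul, mul_pow, hsq, hmat, hhw, Complex.norm_real,
      Real.norm_of_nonneg ha0, Complex.ofReal_re]
    rcases eq_or_ne a 0 with h0 | h0
    · simp [h0]
    · field_simp
  · have htr : A * (Bᴴ * B) * Aᴴ = (A * Bᴴ) * (A * Bᴴ)ᴴ := by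
      simp [Matrix.conjTranspose_mul, Matrix.mul_assoc]
    rw [htr, Matrix.re_trace_mul_conjTranspose_self]
    have key := Matrix.sum_norm_sq_mulVec_le (A * Bᴴ) w
    simp only [Matrix.mulVec_smul, Pi.smul_apply, norm_smul, mul_pow, hsq, Matrix.mulVec_mulVec,
      ← Finset.mul_sum]
    refine inv_mul_le_of_le_mul₀ ha0 ?_ (key.trans_eq (mul_comm _ _))
    exact Finset.sum_nonneg fun j _ => Finset.sum_nonneg fun k _ => sq_nonneg _

/-- Beamforming is optimal for the MISO secondary channel even with multiple primary
receivers: a rank-one covariance `S = v vᴴ` achieves the supremum of `log₂(1 + h S hᴴ)`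
subject to `Tr S ≤ Pt` and `Tr(G_k S G_kᴴ) ≤ Γ_k` for every `k`. -/
theorem stmt_13 (Mt K : ℕ) (hK : 1 ≤ K)
    (h : Matrix (Fin 1) (Fin Mt) ℂ) (hh : h ≠ 0)
    (Mk : Fin K → ℕ) (G : (k : Fin K) → Matrix (Fin (Mk k)) (Fin Mt) ℂ)
    (Γ : Fin K → ℝ) (hΓ : ∀ k, 0 ≤ Γ k) (Pt : ℝ) (hPt : 0 < Pt) :
    ∃ v : Fin Mt → ℂ,
      (∑ i, ‖v i‖ ^ 2) ≤ Pt ∧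
      (∀ k, (∑ j, ‖(G k).mulVec v j‖ ^ 2) ≤ Γ k) ∧
      Real.logb 2 (1 + ‖∑ i, h 0 i * v i‖ ^ 2) =
        sSup {r : ℝ | ∃ S : Matrix (Fin Mt) (Fin Mt) ℂ, S.PosSemidef ∧
          S.trace.re ≤ Pt ∧ (∀ k, (G k * S * (G k)ᴴ).trace.re ≤ Γ k) ∧
          r = Real.logb 2 (1 + ((h * S * hᴴ) 0 0).re)} := by
  set F : Set (Fin Mt → ℂ) := {v | (∑ i, ‖v i‖ ^ 2) ≤ Pt ∧
    ∀ k, (∑ j, ‖(G k).mulVec v j‖ ^ 2) ≤ Γ k} with hF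
  have hclosed : IsClosed F := by
    have hG : ∀ k, Continuous fun v : Fin Mt → ℂ => (G k).mulVec v := fun k =>
      Continuous.matrix_mulVec continuous_const continuous_id
    have h₁ : IsClosed {v : Fin Mt → ℂ | ∑ i, ‖v i‖ ^ 2 ≤ Pt} :=
      isClosed_le (by fun_prop) continuous_const
    have h₂ : IsClosed (⋂ k, {v : Fin Mt → ℂ | ∑ j, ‖(G k).mulVec v j‖ ^ 2 ≤ Γ k}) :=
      isClosed_iInter fun k => isClosed_le (continuous_finsetSum _ fun j _ =>
        (((continuous_apply j).comp (hG k)).norm).pow 2) continuous_const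
    convert h₁.inter h₂ using 1
    ext v
    simp [hF]
  have hbdd : Bornology.IsBounded F := by
    refine (Metric.isBounded_closedBall (x := (0 : Fin Mt → ℂ)) (r := √Pt)).subset ?_
    rintro v ⟨hv, -⟩
    rw [mem_closedBall_zero_iff, pi_norm_le_iff_of_nonneg (Real.sqrt_nonneg _)]
    refine fun i => Real.le_sqrt_of_sq_le (le_trans ?_ hv)
    exact Finset.single_le_sum (f := fun i => ‖v i‖ ^ 2) (fun _ _ => by positivity)
      (Finset.mem_univ i)
  have hne : F.Nonempty := ⟨0, by simpa using hPt.le, fun k => by simpa using hΓ k⟩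
  have hcont : Continuous fun v : Fin Mt → ℂ => ‖∑ i, h 0 i * v i‖ ^ 2 := by fun_prop
  obtain ⟨v, hvF, hmax⟩ := (Metric.isCompact_of_isClosed_isBounded hclosed hbdd).exists_isMaxOn hne
    hcont.continuousOn
  refine ⟨v, hvF.1, hvF.2, Eq.symm (IsGreatest.csSup_eq ⟨?_, ?_⟩)⟩
  · refine ⟨vecMulVec v (star v), Matrix.posSemidef_vecMulVec_self_star v, ?_, fun k => ?_, ?_⟩
    · have := Matrix.re_trace_mul_vecMulVec_star (1 : Matrix (Fin Mt) (Fin Mt) ℂ) v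
      simp only [one_mul, conjTranspose_one, mul_one, one_mulVec] at this
      exact this.trans_le hvF.1
    · exact (Matrix.re_trace_mul_vecMulVec_star (G k) v).trans_le (hvF.2 k)
    · have := Matrix.re_trace_mul_vecMulVec_star h v
      rw [Matrix.trace_fin_one, Fin.sum_univ_one] at this
      rw [this]
      rfl
  · rintro r ⟨S, hS, htr, hGS, rfl⟩
    obtain ⟨u, hu, hle⟩ := hS.exists_rankOne_le h
    have huF : u ∈ F := by
      refine ⟨?_, fun k => (hle _ (G k)).trans (hGS k)⟩
      have := hle Mt 1
      simp only [one_mul, conjTranspose_one, mul_one, one_mulVec] at this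
      exact this.trans htr
    have hm : ‖(h *ᵥ u) 0‖ ^ 2 ≤ ‖∑ i, h 0 i * v i‖ ^ 2 := hmax huF
    rw [← hu]
    exact Real.logb_le_logb_of_le one_lt_two (by positivity) (by linarith)
end

section
/- Let H ∈ ℂ^{M_r×M_t}, let g ∈ ℂ^{1×M_t} be nonzero, set ĝ = g^†/‖g‖ and H⊥ = H(I − ĝ ĝ^†), and let γ ≥ 0. Then for every Hermitian positive semidefinite S ∈ ℂ^{M_t×M_t} with g S g^† ≤ γ, one has log₂ det(I + H S H^†) ≤ log₂ det(I + 2 H⊥ S H⊥^†) + log₂(1 + 2γ ‖H ĝ‖² / ‖g‖²). -/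
open Matrix
open scoped ComplexOrder

/-- The unit column vector `ĝ = gᴴ/‖g‖`, as an `Mt × 1` matrix. -/
noncomputable def gcol (Mt : ℕ) (g : Matrix (Fin 1) (Fin Mt) ℂ) :
    Matrix (Fin Mt) (Fin 1) ℂ :=
  ((Real.sqrt (∑ i, ‖g 0 i‖ ^ 2) : ℝ) : ℂ)⁻¹ • gᴴ

namespace Matrix

variable {n : Type*} [Fintype n] [DecidableEq n]

/-- The determinant of `1 + P` is at least `1` when `P` is positive semidefinite. -/
theorem PosSemidef.one_le_det_one_add {P : Matrix n n ℂ} (hP : P.PosSemidef) :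
    1 ≤ (1 + P).det := by
  have hA : (1 + P).IsHermitian := isHermitian_one.add hP.isHermitian
  rw [hA.det_eq_prod_eigenvalues, ← Complex.ofReal_one]
  rw [← Complex.coe_algebraMap, ← map_prod]
  refine Complex.real_le_real.mpr (Finset.one_le_prod fun i _ => ?_)
  rw [hA.eigenvalues_eq]
  have h := (hP.dotProduct_mulVec_nonneg (hA.eigenvectorBasis i)).1
  have h1 : star (⇑(hA.eigenvectorBasis i)) ⬝ᵥ ⇑(hA.eigenvectorBasis i) = 1 := by
    have := hA.eigenvectorBasis.inner_eq_one i
    rwa [EuclideanSpace.inner_eq_star_dotProduct, dotProduct_comm] at this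
  rw [add_mulVec, one_mulVec, dotProduct_add, h1]
  simpa using h

open scoped MatrixOrder Matrix.Norms.L2Operator in
/-- Every positive semidefinite matrix has the form `Cᴴ C`. -/
theorem PosSemidef.exists_eq_conjTranspose_mul_self {P : Matrix n n ℂ} (hP : P.PosSemidef) :
    ∃ C : Matrix n n ℂ, P = Cᴴ * C :=
  CStarAlgebra.nonneg_iff_eq_star_mul_self.mp hP.nonneg

/-- The factorisation `det (A + Cᴴ C) = det A * det (1 + C A⁻¹ Cᴴ)`. -/
theorem PosDef.det_add_conjTranspose_mul_self {A : Matrix n n ℂ} (hA : A.PosDef)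
    (C : Matrix n n ℂ) :
    (A + Cᴴ * C).det = A.det * (1 + C * A⁻¹ * Cᴴ).det := by
  have hu : IsUnit A.det := hA.det_pos.ne'.isUnit
  rw [mul_assoc C, det_one_add_mul_comm, ← det_mul, mul_add, mul_one, mul_assoc A⁻¹,
    mul_nonsing_inv_cancel_left _ _ hu]

/-- The determinant is monotone in the Loewner order. -/
theorem PosDef.det_le_det_add {A B : Matrix n n ℂ} (hA : A.PosDef) (hB : B.PosSemidef) :
    A.det ≤ (A + B).det := by
  obtain ⟨C, rfl⟩ := hB.exists_eq_conjTranspose_mul_self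
  rw [hA.det_add_conjTranspose_mul_self]
  exact le_mul_of_one_le_right hA.det_pos.le
    (hA.inv.posSemidef.mul_mul_conjTranspose_same C).one_le_det_one_add

/-- If `X` is positive semidefinite, then `(1 + X)⁻¹ ≤ 1` in the Loewner order. -/
theorem PosSemidef.one_sub_inv_one_add {X : Matrix n n ℂ} (hX : X.PosSemidef) :
    (1 - (1 + X)⁻¹).PosSemidef := by
  have hA : (1 + X).PosDef := PosDef.one.add_posSemidef hX
  have hu : IsUnit (1 + X).det := hA.det_pos.ne'.isUnit
  have hXX : (X + Xᴴ * X).PosSemidef := hX.add (posSemidef_conjTranspose_mul_self X)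
  have key := hXX.mul_mul_conjTranspose_same (1 + X)⁻¹
  rw [hA.inv.isHermitian.eq, hX.isHermitian.eq] at key
  have hfac : X + X * X = (1 + X) * (1 + X) - (1 + X) := by noncomm_ring
  rwa [hfac, mul_sub, nonsing_inv_mul_cancel_left _ _ hu, nonsing_inv_mul _ hu, sub_mul,
    mul_nonsing_inv _ hu, one_mul] at key

/-- Subadditivity: `det (1 + X + Y) ≤ det (1 + X) * det (1 + Y)`. -/
theorem PosSemidef.det_one_add_add_le {X Y : Matrix n n ℂ} (hX : X.PosSemidef)
    (hY : Y.PosSemidef) : (1 + X + Y).det ≤ (1 + X).det * (1 + Y).det := by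
  have hA : (1 + X).PosDef := PosDef.one.add_posSemidef hX
  obtain ⟨C, rfl⟩ := hY.exists_eq_conjTranspose_mul_self
  rw [hA.det_add_conjTranspose_mul_self, det_one_add_mul_comm Cᴴ C]
  refine mul_le_mul_of_nonneg_left ?_ hA.det_pos.le
  have h1 : (1 + C * (1 + X)⁻¹ * Cᴴ).PosDef :=
    PosDef.one.add_posSemidef (hA.inv.posSemidef.mul_mul_conjTranspose_same C)
  have h2 := h1.det_le_det_add (hX.one_sub_inv_one_add.mul_mul_conjTranspose_same C)
  have hsum : 1 + C * (1 + X)⁻¹ * Cᴴ + C * (1 - (1 + X)⁻¹) * Cᴴ = 1 + C * Cᴴ := by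
    noncomm_ring
  rwa [hsum] at h2

/-- `(A + B) S (A + B)ᴴ ≤ 2 (A S Aᴴ + B S Bᴴ)` at the level of determinants, combined with
subadditivity of the determinant. -/
theorem PosSemidef.det_one_add_mul_mul_conjTranspose_add_le {m : Type*} [Fintype m]
    {S : Matrix m m ℂ} (hS : S.PosSemidef) (A B : Matrix n m ℂ) :
    (1 + (A + B) * S * (A + B)ᴴ).det ≤
      (1 + (2 : ℂ) • (A * S * Aᴴ)).det * (1 + (2 : ℂ) • (B * S * Bᴴ)).det := by
  have hH : (1 + (A + B) * S * (A + B)ᴴ).PosDef :=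
    PosDef.one.add_posSemidef (hS.mul_mul_conjTranspose_same _)
  have hmono := hH.det_le_det_add (hS.mul_mul_conjTranspose_same (A - B))
  have hpar : 1 + (A + B) * S * (A + B)ᴴ + (A - B) * S * (A - B)ᴴ =
      1 + (2 : ℂ) • (A * S * Aᴴ) + (2 : ℂ) • (B * S * Bᴴ) := by
    simp only [conjTranspose_add, conjTranspose_sub, Matrix.add_mul, Matrix.sub_mul,
      Matrix.mul_add, Matrix.mul_sub, two_smul]
    abel
  rw [hpar] at hmono
  have h2 : (0 : ℂ) ≤ 2 := by norm_num
  exact hmono.trans (((hS.mul_mul_conjTranspose_same A).smul h2).det_one_add_add_le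
    ((hS.mul_mul_conjTranspose_same B).smul h2))

end Matrix

/-- The input power along `ĝ` is `g S gᴴ / ‖g‖²`. -/
theorem gcol_conjTranspose_mul_mul (Mt : ℕ) (g : Matrix (Fin 1) (Fin Mt) ℂ)
    (S : Matrix (Fin Mt) (Fin Mt) ℂ) :
    (gcol Mt g)ᴴ * S * gcol Mt g = (((∑ i, ‖g 0 i‖ ^ 2 : ℝ) : ℂ)⁻¹) • (g * S * gᴴ) := by
  have hN : (0 : ℝ) ≤ ∑ i, ‖g 0 i‖ ^ 2 := by positivity
  simp only [gcol, conjTranspose_smul, conjTranspose_conjTranspose, Matrix.smul_mul,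
    Matrix.mul_smul, smul_smul, star_inv₀, Complex.star_def, Complex.conj_ofReal]
  rw [← mul_inv, ← Complex.ofReal_mul, Real.mul_self_sqrt hN]

/-- The squared norm of a column vector `w` is the entry of `wᴴ w`. -/
theorem conjTranspose_mul_self_apply_zero {m : Type*} [Fintype m] (w : Matrix m (Fin 1) ℂ) :
    (wᴴ * w) 0 0 = ((∑ i, ‖w i 0‖ ^ 2 : ℝ) : ℂ) := by
  simp [mul_apply, Complex.conj_mul']

/-- Key bound in the proof of the high-power multiplexing gain: for `S ⪰ 0` with
`g S gᴴ ≤ γ`, writing `H⊥ = H(I − ĝ ĝᴴ)`,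
`log₂ det(I + H S Hᴴ) ≤ log₂ det(I + 2 H⊥ S H⊥ᴴ) + log₂(1 + 2γ ‖H ĝ‖²/‖g‖²)`. -/
theorem stmt_18 (Mr Mt : ℕ) (H : Matrix (Fin Mr) (Fin Mt) ℂ)
    (g : Matrix (Fin 1) (Fin Mt) ℂ) (hg : g ≠ 0) (γ : ℝ) (hγ : 0 ≤ γ)
    (S : Matrix (Fin Mt) (Fin Mt) ℂ) (hS : S.PosSemidef)
    (hIc : ((g * S * gᴴ) 0 0).re ≤ γ) :
    Real.logb 2 ((1 + H * S * Hᴴ).det.re) ≤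
      Real.logb 2 ((1 + (2 : ℂ) • (H * (1 - gcol Mt g * (gcol Mt g)ᴴ) * S
          * (H * (1 - gcol Mt g * (gcol Mt g)ᴴ))ᴴ)).det.re)
      + Real.logb 2 (1 + 2 * γ * (∑ i, ‖(H * gcol Mt g) i 0‖ ^ 2)
          / (∑ i, ‖g 0 i‖ ^ 2)) := by
  have hN : 0 < ∑ i, ‖g 0 i‖ ^ 2 := by
    obtain ⟨i, hi⟩ : ∃ i, g 0 i ≠ 0 := by
      by_contra! h
      exact hg (Matrix.ext fun a b => by rw [Subsingleton.elim a 0, h b, Matrix.zero_apply])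
    exact Finset.sum_pos' (fun _ _ => by positivity) ⟨i, Finset.mem_univ i, by positivity⟩
  set u := gcol Mt g with hu
  set N := ∑ i, ‖g 0 i‖ ^ 2 with hNdef
  have hsplit : H * (1 - u * uᴴ) + H * u * uᴴ = H := by
    rw [Matrix.mul_sub, Matrix.mul_one, ← Matrix.mul_assoc, sub_add_cancel]
  have hdet := hS.det_one_add_mul_mul_conjTranspose_add_le (H * (1 - u * uᴴ)) (H * u * uᴴ)
  rw [hsplit] at hdet
  set A := H * (1 - u * uᴴ)
  set w := H * u
  set W := ∑ i, ‖w i 0‖ ^ 2 with hW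
  set c := (g * S * gᴴ) 0 0 with hc
  have hW0 : 0 ≤ W := by positivity
  have hgS : (0 : ℂ) ≤ c := (hS.mul_mul_conjTranspose_same g).diag_nonneg
  have hcre : (c.re : ℂ) = c := (Complex.eq_re_of_ofReal_le hgS).symm
  have hrank : (1 + (2 : ℂ) • (w * uᴴ * S * (w * uᴴ)ᴴ)).det
      = ((1 + 2 * c.re * W / N : ℝ) : ℂ) := by
    have hre : (2 : ℂ) • (w * uᴴ * S * (w * uᴴ)ᴴ) =
        w * ((2 : ℂ) • (uᴴ * S * u) * wᴴ) := by
      simp only [conjTranspose_mul, conjTranspose_conjTranspose, Matrix.mul_assoc,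
        Matrix.smul_mul, Matrix.mul_smul]
    rw [hre, det_one_add_mul_comm, hu, gcol_conjTranspose_mul_mul, det_fin_one,
      Matrix.mul_assoc]
    simp only [Matrix.add_apply, Matrix.one_apply_eq, Matrix.smul_mul, Matrix.smul_apply,
      smul_eq_mul]
    rw [mul_apply, Fin.sum_univ_one, conjTranspose_mul_self_apply_zero, ← hW, ← hNdef, ← hc, ← hcre]
    push_cast
    simp only [Complex.ofReal_re]
    ring
  rw [hrank] at hdet
  have h2 : (0 : ℂ) ≤ 2 := by norm_num
  have hpos : 0 < (1 + H * S * Hᴴ).det :=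
    (PosDef.one.add_posSemidef (hS.mul_mul_conjTranspose_same H)).det_pos
  have hposA : 0 < (1 + (2 : ℂ) • (A * S * Aᴴ)).det :=
    (PosDef.one.add_posSemidef ((hS.mul_mul_conjTranspose_same A).smul h2)).det_pos
  have hle := (Complex.le_def.mp hdet).1
  rw [Complex.re_mul_ofReal] at hle
  have hpos' := (Complex.lt_def.mp hpos).1
  have hposA' := (Complex.lt_def.mp hposA).1
  rw [Complex.zero_re] at hpos' hposA'
  have hγpos : 0 < 1 + 2 * γ * W / N := by positivity
  rw [← Real.logb_mul hposA'.ne' hγpos.ne']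
  refine Real.logb_le_logb_of_le one_lt_two hpos' (hle.trans ?_)
  gcongr
end
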